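/- Let f, g_1, …, g_m ∈ ℝ[x] with g = (g_1,…,g_m). Assume that f is non-negative on S(g), that the image f(C(g)) := {f(x) : x ∈ C(g)} is a finite set, and that S(g) satisfies the Archimedean condition. Then there exists q ∈ Q(g)[x, λ̄] such that f − q vanishes identically on V(h_FJ) ⊂ ℝ^{n+m+1}. -/

import Mathlib

open MvPolynomial

noncomputable section

/-- `p` is a sum of squares of polynomials. -/
def IsSOS {σ : Type*} (p : MvPolynomial σ ℝ) : Prop :=
  ∃ (k : ℕ) (q : Fin k → MvPolynomial σ ℝ), p = ∑ i, q i ^ 2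

/-- Membership in the quadratic module `Q(g)` generated by the tuple `g`. -/
def InQM {σ ι : Type*} [Fintype ι] (g : ι → MvPolynomial σ ℝ) (p : MvPolynomial σ ℝ) : Prop :=
  ∃ (s0 : MvPolynomial σ ℝ) (s : ι → MvPolynomial σ ℝ),
    IsSOS s0 ∧ (∀ j, IsSOS (s j)) ∧ p = s0 + ∑ j, s j * g j

/-- The basic semi-algebraic set `S(g)`. -/
def Sg {n m : ℕ} (g : Fin m → MvPolynomial (Fin n) ℝ) : Set (Fin n → ℝ) :=
  {x | ∀ j, 0 ≤ eval x (g j)}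

/-- `S(g)` satisfies the Archimedean condition. -/
def ArchCond {n m : ℕ} (g : Fin m → MvPolynomial (Fin n) ℝ) : Prop :=
  ∃ R : ℝ, 0 < R ∧ InQM g (C R - ∑ i : Fin n, X i ^ 2)

/-- The set of critical points `C(g)`. -/
def Cset {n m : ℕ} (g : Fin m → MvPolynomial (Fin n) ℝ) : Set (Fin n → ℝ) :=
  {x | ∃ lam : Fin m → ℝ, lam ≠ 0 ∧
    (∀ i, ∑ j, lam j * eval x (pderiv i (g j)) = 0) ∧
    (∀ j, lam j * eval x (g j) = 0)}

/-- The real variety `V(h_FJ)` of the Fritz John system attached to `f` and `g`. -/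
def VFJ {n m : ℕ} (f : MvPolynomial (Fin n) ℝ) (g : Fin m → MvPolynomial (Fin n) ℝ) :
    Set ((Fin n → ℝ) × (Fin (m + 1) → ℝ)) :=
  {p | (∀ i, p.2 0 * eval p.1 (pderiv i f) = ∑ j, p.2 j.succ * eval p.1 (pderiv i (g j)))
    ∧ (∀ j, p.2 j.succ * eval p.1 (g j) = 0)
    ∧ (∑ j, p.2 j ^ 2 = 1)}

theorem Derivation.aeval_mvPolynomial {k A M σ : Type*} [Fintype σ] [CommRing k] [CommRing A]
    [Algebra k A] [AddCommGroup M] [Module k M] [Module A M] [IsScalarTower k A M]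
    (D : Derivation k A M) (x : σ → A) (p : MvPolynomial σ k) :
    D (aeval x p) = ∑ i, aeval x (pderiv i p) • D (x i) := by
  classical
  induction p using MvPolynomial.induction_on with
  | C a => simp
  | add p q hp hq => simp [hp, hq, add_smul, Finset.sum_add_distrib]
  | mul_X p i hp =>
    simp only [map_mul, aeval_X, Derivation.leibniz, hp, map_add, smul_eq_mul, add_smul,
      Finset.sum_add_distrib, pderiv_X, Pi.single_apply, Finset.smul_sum, smul_smul]
    congr 1
    · rw [Finset.sum_eq_single i] <;> simp +contextual [Ne.symm, eq_comm]

theorem isAlgebraic_of_kaehlerDifferential_eq_zero {k K : Type*} [Field k] [CharZero k] [Field K]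
    [Algebra k K] [Algebra.EssFiniteType k K] (f : K) (h : KaehlerDifferential.D k K f = 0) :
    IsAlgebraic k f := by
  let E := IntermediateField.adjoin k {f}
  have : CharZero E := charZero_of_injective_algebraMap (algebraMap k E).injective
  have : Algebra.EssFiniteType E K := .of_comp k E K
  have hE : Algebra.EssFiniteType k E :=
    IntermediateField.essFiniteType_iff.2 ⟨{f}, by simp [E]⟩
  have hinj : Function.Injective (KaehlerDifferential.mapBaseChange k E K) := by
    rw [injective_iff_map_eq_zero]
    intro x hx
    obtain ⟨y, rfl⟩ := (Algebra.H1Cotangent.exact_δ_mapBaseChange k E K x).1 hx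
    rw [Subsingleton.elim y 0, map_zero]
  let f' : E := ⟨f, IntermediateField.mem_adjoin_simple_self k f⟩
  have hf' : KaehlerDifferential.D k E f' = 0 := by
    apply Module.FaithfullyFlat.tensorProduct_mk_injective (A := E) (B := K) (Ω[E⁄k])
    apply hinj
    simpa using h
  have hD : KaehlerDifferential.D k E = 0 := by
    ext ⟨x, hx⟩
    induction hx using IntermediateField.adjoin_induction with
    | mem x hx => obtain rfl : x = f := hx; exact hf'
    | algebraMap x => exact Derivation.map_algebraMap _ x
    | add x y hx hy h1 h2 =>
      have := (KaehlerDifferential.D k E).map_add ⟨x, hx⟩ ⟨y, hy⟩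
      rw [h1, h2] at this; simpa using this
    | inv x hx h1 =>
      have := (KaehlerDifferential.D k E).leibniz_inv ⟨x, hx⟩
      rw [h1] at this; exact this.trans (smul_zero _)
    | mul x y hx hy h1 h2 =>
      have := (KaehlerDifferential.D k E).leibniz ⟨x, hx⟩ ⟨y, hy⟩
      rw [h1, h2] at this; simpa using this
  have : Algebra.FormallyUnramified k E := by
    constructor
    rw [← Submodule.subsingleton_iff E, ← subsingleton_iff_bot_eq_top,
      ← KaehlerDifferential.span_range_derivation, hD, eq_comm, Submodule.span_eq_bot]
    rintro _ ⟨y, rfl⟩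
    rfl
  have := Algebra.FormallyUnramified.isSeparable k E
  have h2 : IsAlgebraic k f' := Algebra.IsAlgebraic.isAlgebraic f'
  simpa using h2.algebraMap (A := K)

/-- A subset of an algebra closed under the operations defining a quadratic module. -/
structure IsQuadraticModule {A : Type*} [CommRing A] (M : Set A) : Prop where
  one_mem : 1 ∈ M
  add_mem : ∀ {a b}, a ∈ M → b ∈ M → a + b ∈ M
  sq_mul_mem : ∀ (b) {a}, a ∈ M → b ^ 2 * a ∈ M

namespace IsQuadraticModule

variable {A : Type*} [CommRing A] {M : Set A}

theorem zero_mem (hM : IsQuadraticModule M) : 0 ∈ M := by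
  simpa using hM.sq_mul_mem 0 hM.one_mem

theorem sq_mem (hM : IsQuadraticModule M) (a : A) : a ^ 2 ∈ M := by
  simpa using hM.sq_mul_mem a hM.one_mem

theorem isSumSq_mul_mem (hM : IsQuadraticModule M) {s a : A} (hs : IsSumSq s) (ha : a ∈ M) :
    s * a ∈ M := by
  induction hs with
  | zero => simpa using hM.zero_mem
  | sq_add b _ ih =>
    rw [add_mul, ← sq]
    exact hM.add_mem (hM.sq_mul_mem b ha) ih

theorem sum_mem (hM : IsQuadraticModule M) {ι : Type*} (t : Finset ι) {a : ι → A}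
    (ha : ∀ i ∈ t, a i ∈ M) : ∑ i ∈ t, a i ∈ M :=
  Finset.sum_induction a (· ∈ M) (fun _ _ => hM.add_mem) hM.zero_mem ha

/-- The quadratic module generated by a quadratic module and one further element. -/
theorem adjoin (hM : IsQuadraticModule M) (a : A) :
    IsQuadraticModule {x | ∃ m ∈ M, ∃ s, IsSumSq s ∧ x = m + a * s} where
  one_mem := ⟨1, hM.one_mem, 0, .zero, by simp⟩
  add_mem := by
    rintro _ _ ⟨m, hm, s, hs, rfl⟩ ⟨m', hm', s', hs', rfl⟩
    exact ⟨_, hM.add_mem hm hm', _, hs.add hs', by ring⟩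
  sq_mul_mem := by
    rintro b _ ⟨m, hm, s, hs, rfl⟩
    exact ⟨_, hM.sq_mul_mem b hm, b * b * s, (IsSumSq.mul_self b).mul hs, by ring⟩

variable [Algebra ℝ A]

theorem algebraMap_mul_mem (hM : IsQuadraticModule M) {r : ℝ} (hr : 0 ≤ r) {a : A}
    (ha : a ∈ M) : algebraMap ℝ A r * a ∈ M := by
  simpa [← map_pow, Real.sq_sqrt hr] using hM.sq_mul_mem (algebraMap ℝ A √r) ha

theorem algebraMap_mem (hM : IsQuadraticModule M) {r : ℝ} (hr : 0 ≤ r) :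
    algebraMap ℝ A r ∈ M := by
  simpa using hM.algebraMap_mul_mem hr hM.one_mem

theorem mul_mem_of_mem_of_neg_mem (hM : IsQuadraticModule M) {x : A} (hx : x ∈ M)
    (hx' : -x ∈ M) (a : A) : a * x ∈ M := by
  have h : algebraMap ℝ A (1 / 2) * 2 = 1 := by
    rw [← map_ofNat (algebraMap ℝ A) 2, ← map_mul]; norm_num
  have := hM.add_mem (hM.sq_mul_mem (algebraMap ℝ A (1 / 2) * (a + 1)) hx)
    (hM.sq_mul_mem (algebraMap ℝ A (1 / 2) * (a - 1)) hx')
  convert this using 1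
  linear_combination (-a * x * (algebraMap ℝ A (1 / 2) * 2 + 1)) * h

/-- The elements `a` such that `N - a` and `N + a` lie in the quadratic module for some real `N`
form a subalgebra. -/
def bounded (hM : IsQuadraticModule M) : Subalgebra ℝ A where
  carrier := {a | ∃ N : ℝ, algebraMap ℝ A N - a ∈ M ∧ algebraMap ℝ A N + a ∈ M}
  algebraMap_mem' r := ⟨|r|, by
    rw [← map_sub, ← map_add]
    exact ⟨hM.algebraMap_mem (by linarith [le_abs_self r]),
      hM.algebraMap_mem (by linarith [neg_abs_le r])⟩⟩
  add_mem' := by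
    rintro a b ⟨N, h1, h2⟩ ⟨N', h1', h2'⟩
    refine ⟨N + N', ?_, ?_⟩
    · convert hM.add_mem h1 h1' using 1
      rw [map_add]; ring
    · convert hM.add_mem h2 h2' using 1
      rw [map_add]; ring
  mul_mem' := by
    have key : ∀ {a : A}, (∃ N : ℝ, algebraMap ℝ A N - a ∈ M ∧ algebraMap ℝ A N + a ∈ M) →
        ∃ N : ℝ, algebraMap ℝ A N - a ^ 2 ∈ M := by
      rintro a ⟨N, h1, h2⟩
      obtain ⟨N, hN, h1, h2⟩ : ∃ N : ℝ, 0 < N ∧ algebraMap ℝ A N - a ∈ M ∧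
          algebraMap ℝ A N + a ∈ M := by
        refine ⟨|N| + 1, by positivity, ?_, ?_⟩
        · convert hM.add_mem h1 (hM.algebraMap_mem (r := |N| + 1 - N)
            (by linarith [le_abs_self N])) using 1
          simp only [map_sub]; ring
        · convert hM.add_mem h2 (hM.algebraMap_mem (r := |N| + 1 - N)
            (by linarith [le_abs_self N])) using 1
          simp only [map_sub]; ring
      refine ⟨N ^ 2, ?_⟩
      have h : algebraMap ℝ A (1 / (2 * N)) * (2 * algebraMap ℝ A N) = 1 := by
        rw [← map_ofNat (algebraMap ℝ A) 2, ← map_mul, ← map_mul, one_div,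
          inv_mul_cancel₀ (by positivity), map_one]
      convert hM.algebraMap_mul_mem (r := 1 / (2 * N)) (by positivity)
        (hM.add_mem (hM.sq_mul_mem (algebraMap ℝ A N + a) h1)
          (hM.sq_mul_mem (algebraMap ℝ A N - a) h2)) using 1
      rw [map_pow]
      linear_combination (a ^ 2 - algebraMap ℝ A N ^ 2) * h
    rintro a b ⟨N, h1, h2⟩ ⟨N', h1', h2'⟩
    obtain ⟨K, hK⟩ := key (a := a + b) ⟨N + N', by
      convert hM.add_mem h1 h1' using 1
      rw [map_add]; ring, by
      convert hM.add_mem h2 h2' using 1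
      rw [map_add]; ring⟩
    obtain ⟨L, hL⟩ := key (a := a - b) ⟨N + N', by
      convert hM.add_mem h1 h2' using 1
      rw [map_add]; ring, by
      convert hM.add_mem h2 h1' using 1
      rw [map_add]; ring⟩
    have h4 : algebraMap ℝ A (1 / 4) * 4 = 1 := by
      rw [← map_ofNat (algebraMap ℝ A) 4, ← map_mul]; norm_num
    have h0 : (0 : ℝ) ≤ 1 / 4 := by norm_num
    have e : ∀ K : ℝ, algebraMap ℝ A (K / 4) = algebraMap ℝ A (1 / 4) * algebraMap ℝ A K := by
      intro K; rw [← map_mul]; congr 1; ring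
    refine ⟨|K| / 4 + |L| / 4, ?_, ?_⟩
    · have := hM.algebraMap_mul_mem h0 (hM.add_mem (hM.add_mem (hM.add_mem hK
        (hM.algebraMap_mem (r := |K| - K) (by linarith [le_abs_self K]))) (hM.sq_mem (a - b)))
        (hM.algebraMap_mem (abs_nonneg L)))
      convert this using 1
      rw [map_add, e |K|, e |L|, map_sub]
      linear_combination a * b * h4
    · have := hM.algebraMap_mul_mem h0 (hM.add_mem (hM.add_mem (hM.add_mem hL
        (hM.algebraMap_mem (r := |L| - L) (by linarith [le_abs_self L]))) (hM.sq_mem (a + b)))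
        (hM.algebraMap_mem (abs_nonneg K)))
      convert this using 1
      rw [map_add, e |K|, e |L|, map_sub]
      linear_combination - a * b * h4

theorem mem_bounded_of_sub_sq_mem (hM : IsQuadraticModule M) {a : A} {N : ℝ}
    (h : algebraMap ℝ A N - a ^ 2 ∈ M) : a ∈ hM.bounded := by
  have half : algebraMap ℝ A (1 / 2) * 2 = 1 := by
    rw [← map_ofNat (algebraMap ℝ A) 2, ← map_mul]; norm_num
  refine ⟨N + (1 / 2) ^ 2, ?_, ?_⟩
  · convert hM.add_mem h (hM.sq_mem (a - algebraMap ℝ A (1 / 2))) using 1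
    rw [map_add, map_pow]; linear_combination a * half
  · convert hM.add_mem h (hM.sq_mem (a + algebraMap ℝ A (1 / 2))) using 1
    rw [map_add, map_pow]; linear_combination - a * half

/-- A proper Archimedean quadratic module is non-negative under some real character. -/
theorem exists_algHom_nonneg (hM : IsQuadraticModule M) (hb : hM.bounded = ⊤)
    (h : -1 ∉ M) : ∃ φ : A →ₐ[ℝ] ℝ, ∀ a ∈ M, 0 ≤ φ a := by
  have harch (a : A) : ∃ N : ℝ, algebraMap ℝ A N - a ∈ M := by
    have : a ∈ hM.bounded := hb ▸ Algebra.mem_top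
    obtain ⟨N, hN, -⟩ := this
    exact ⟨N, hN⟩
  obtain ⟨T, hMT, hT⟩ := zorn_subset_nonempty {T : Set A | IsQuadraticModule T ∧ -1 ∉ T} (by
    rintro c hc hchain ⟨T₀, hT₀⟩
    refine ⟨⋃₀ c, ⟨⟨⟨T₀, hT₀, (hc hT₀).1.one_mem⟩, ?_, ?_⟩, ?_⟩,
      fun T hT => Set.subset_sUnion_of_mem hT⟩
    · rintro a b ⟨T, hT, ha⟩ ⟨T', hT', hb⟩
      rcases hchain.total hT hT' with h | h
      · exact ⟨T', hT', (hc hT').1.add_mem (h ha) hb⟩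
      · exact ⟨T, hT, (hc hT).1.add_mem ha (h hb)⟩
    · rintro b a ⟨T, hT, ha⟩
      exact ⟨T, hT, (hc hT).1.sq_mul_mem b ha⟩
    · rintro ⟨T, hT, h⟩
      exact (hc hT).2 h) M ⟨hM, h⟩
  obtain ⟨hTq, hT1⟩ := hT.prop
  have hext {a : A} (ha : a ∉ T) : ∃ m ∈ T, ∃ s, IsSumSq s ∧ -1 = m + a * s := by
    by_contra hcon
    refine ha (hT.le_of_ge (y := {x | ∃ m ∈ T, ∃ s, IsSumSq s ∧ x = m + a * s})
      ⟨hTq.adjoin a, hcon⟩ (fun m hm => ⟨m, hm, 0, .zero, by simp⟩)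
      ⟨0, hTq.zero_mem, 1, by simp, by simp⟩)
  have htotal (a : A) : a ∈ T ∨ -a ∈ T := by
    by_contra! hcon
    obtain ⟨m, hm, s, hs, h1⟩ := hext hcon.1
    obtain ⟨m', hm', t, ht, h2⟩ := hext hcon.2
    have hsT : s ∈ T := by simpa using hTq.isSumSq_mul_mem hs hTq.one_mem
    have htT : t ∈ T := by simpa using hTq.isSumSq_mul_mem ht hTq.one_mem
    have htn : -t ∈ T := by
      convert hTq.add_mem (hTq.isSumSq_mul_mem ht hm)
        (hTq.add_mem hsT (hTq.isSumSq_mul_mem hs hm')) using 1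
      linear_combination t * h1 + s * h2
    refine hT1 ?_
    convert hTq.add_mem hm' (hTq.mul_mem_of_mem_of_neg_mem htn (by simpa using htT) a) using 1
    linear_combination h2
  have hneg {r : ℝ} (hr : r < 0) : algebraMap ℝ A r ∉ T := fun hmem => hT1 <| by
    convert hTq.algebraMap_mul_mem (r := (-r)⁻¹) (by simpa using hr.le) hmem using 1
    rw [← map_mul, inv_neg, neg_mul, inv_mul_cancel₀ hr.ne, map_neg, map_one]
  have hclosed {a : A} (ha : ∀ ε > 0, a + algebraMap ℝ A ε ∈ T) : a ∈ T := by
    by_contra hcon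
    obtain ⟨m, hm, s, hs, h1⟩ := hext hcon
    obtain ⟨N, hN⟩ := harch s
    have hε : (0 : ℝ) < 1 / (2 * (|N| + 1)) := by positivity
    set ε : ℝ := 1 / (2 * (|N| + 1)) with hεdef
    have hlt : ε * N - 1 < 0 := by
      have : ε * (|N| + 1) = 1 / 2 := by rw [hεdef]; field_simp
      nlinarith [le_abs_self N]
    refine hneg hlt ?_
    convert hTq.add_mem (hTq.add_mem hm (hTq.isSumSq_mul_mem hs (ha ε hε)))
      (hTq.algebraMap_mul_mem hε.le (hMT hN)) using 1
    rw [map_sub, map_mul, map_one]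
    linear_combination h1
  let J : Ideal A :=
    { carrier := {a | a ∈ T ∧ -a ∈ T}
      add_mem' := by
        rintro a b ⟨h1, h2⟩ ⟨h3, h4⟩
        exact ⟨hTq.add_mem h1 h3, by rw [neg_add]; exact hTq.add_mem h2 h4⟩
      zero_mem' := ⟨hTq.zero_mem, by simpa using hTq.zero_mem⟩
      smul_mem' := by
        rintro c a ⟨h1, h2⟩
        refine ⟨hTq.mul_mem_of_mem_of_neg_mem h1 h2 c, ?_⟩
        simpa using hTq.mul_mem_of_mem_of_neg_mem h1 h2 (-c) }
  have hreal (a : A) : ∃ r : ℝ, a - algebraMap ℝ A r ∈ J := by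
    obtain ⟨N, hN⟩ := harch a
    obtain ⟨N', hN'⟩ := harch (-a)
    let U : Set ℝ := {r | a - algebraMap ℝ A r ∈ T}
    have hUb : BddAbove U := ⟨N, fun r hr => by
      by_contra! hlt
      refine hneg (sub_neg.2 hlt) ?_
      convert hTq.add_mem hr (hMT hN) using 1
      rw [map_sub]; ring⟩
    have hUn : U.Nonempty := ⟨-N', by
      change a - algebraMap ℝ A (-N') ∈ T
      convert hMT hN' using 1
      rw [map_neg]; ring⟩
    refine ⟨sSup U, hclosed fun ε hε => ?_, hclosed fun ε hε => ?_⟩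
    · obtain ⟨r, hr, hlt⟩ := exists_lt_of_lt_csSup hUn (sub_lt_self (sSup U) hε)
      convert hTq.add_mem hr (hTq.algebraMap_mem (r := r - (sSup U - ε)) (by linarith)) using 1
      simp only [map_sub]; ring
    · have : a - algebraMap ℝ A (sSup U + ε) ∉ T := fun hmem => by
        have := le_csSup hUb (show sSup U + ε ∈ U from hmem)
        linarith
      convert (htotal _).resolve_left this using 1
      rw [map_add]; ring
  have hbij : Function.Bijective (algebraMap ℝ (A ⧸ J)) := by
    constructor
    · have : Nontrivial (A ⧸ J) := Ideal.Quotient.nontrivial_iff.2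
        ((Ideal.ne_top_iff_one J).2 fun h1 => hT1 h1.2)
      exact (algebraMap ℝ (A ⧸ J)).injective
    · intro y
      obtain ⟨a, rfl⟩ := Ideal.Quotient.mk_surjective y
      obtain ⟨r, hr⟩ := hreal a
      exact ⟨r, ((Ideal.Quotient.mk_eq_mk_iff_sub_mem _ _).2 hr).symm⟩
  let e := AlgEquiv.ofBijective (Algebra.ofId ℝ (A ⧸ J)) hbij
  refine ⟨(e.symm : (A ⧸ J) →ₐ[ℝ] ℝ).comp (Ideal.Quotient.mkₐ ℝ J), fun a ha => ?_⟩
  obtain ⟨r, hr⟩ := hreal a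
  have hφ : e.symm (Ideal.Quotient.mk J a) = r := by
    rw [AlgEquiv.symm_apply_eq]
    exact (Ideal.Quotient.mk_eq_mk_iff_sub_mem _ _).2 hr
  change 0 ≤ e.symm (Ideal.Quotient.mk J a)
  rw [hφ]
  by_contra! hlt
  refine hneg hlt ?_
  convert hTq.add_mem (hMT ha) hr.2 using 1
  ring

end IsQuadraticModule

theorem finite_values_of_fritzJohn_prime {n m : ℕ} (f : MvPolynomial (Fin n) ℝ)
    (g : Fin m → MvPolynomial (Fin n) ℝ) (P : Ideal (MvPolynomial (Fin n ⊕ Fin (m + 1)) ℝ))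
    [P.IsPrime]
    (hgrad : ∀ i, X (Sum.inr 0) * rename Sum.inl (pderiv i f) -
      ∑ j : Fin m, X (Sum.inr j.succ) * rename Sum.inl (pderiv i (g j)) ∈ P)
    (hcompl : ∀ j : Fin m, X (Sum.inr j.succ) * rename Sum.inl (g j) ∈ P)
    (h0 : X (Sum.inr 0) ∉ P) :
    {c : ℝ | ∃ z, (∀ p ∈ P, eval z p = 0) ∧ eval z (rename Sum.inl f) = c}.Finite := by
  let B := MvPolynomial (Fin n ⊕ Fin (m + 1)) ℝ ⧸ P
  let K := FractionRing B
  have : Algebra.EssFiniteType B K := .of_isLocalization K (nonZeroDivisors B)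
  have : Algebra.EssFiniteType ℝ K := .comp ℝ B K
  let φ : MvPolynomial (Fin n ⊕ Fin (m + 1)) ℝ →ₐ[ℝ] K :=
    (IsScalarTower.toAlgHom ℝ B K).comp (Ideal.Quotient.mkₐ ℝ P)
  have hφ (p) : φ p = 0 ↔ p ∈ P := by
    change algebraMap B K (Ideal.Quotient.mk P p) = 0 ↔ _
    rw [FaithfulSMul.algebraMap_eq_zero_iff, Ideal.Quotient.eq_zero_iff_mem]
  let x : Fin n → K := fun i => φ (X (Sum.inl i))
  let l : Fin (m + 1) → K := fun j => φ (X (Sum.inr j))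
  have hren (p : MvPolynomial (Fin n) ℝ) : φ (rename Sum.inl p) = aeval x p := by
    have : (φ.comp (rename Sum.inl)) = aeval x := by ext i; simp [x]
    exact DFunLike.congr_fun this p
  let D := KaehlerDifferential.D ℝ K
  have hcompl' (j : Fin m) : l j.succ • D (aeval x (g j)) = 0 := by
    have := (hφ _).2 (hcompl j)
    rw [map_mul, hren, mul_eq_zero] at this
    rcases this with h | h
    · rw [show l j.succ = 0 from h, zero_smul]
    · rw [h, map_zero, smul_zero]
  have hgrad' (i : Fin n) :
      l 0 * aeval x (pderiv i f) = ∑ j : Fin m, l j.succ * aeval x (pderiv i (g j)) := by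
    have := (hφ _).2 (hgrad i)
    simpa only [map_sub, map_sum, map_mul, hren, sub_eq_zero] using this
  have hD : l 0 • D (aeval x f) = 0 := by
    calc l 0 • D (aeval x f) = ∑ j : Fin m, l j.succ • D (aeval x (g j)) := by
          simp_rw [Derivation.aeval_mvPolynomial, Finset.smul_sum]
          rw [Finset.sum_comm]
          refine Finset.sum_congr rfl fun i _ => ?_
          rw [smul_smul, hgrad', Finset.sum_smul]
          simp_rw [smul_smul]
      _ = 0 := Finset.sum_eq_zero fun j _ => hcompl' j
  have hDf : D (aeval x f) = 0 := (smul_eq_zero.1 hD).resolve_left fun h => h0 ((hφ _).1 h)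
  obtain ⟨r, hr, hrf⟩ := isAlgebraic_of_kaehlerDifferential_eq_zero _ hDf
  refine (Polynomial.finite_setOfPred_isRoot hr).subset ?_
  rintro _ ⟨z, hz, rfl⟩
  rw [← hren, Polynomial.aeval_algHom_apply, hφ] at hrf
  have := hz _ hrf
  rw [← MvPolynomial.coe_aeval_eq_eval, RingHom.coe_coe, ← Polynomial.aeval_algHom_apply] at this
  simpa [Polynomial.IsRoot, MvPolynomial.coe_aeval_eq_eval] using this

theorem finite_image_VFJ {n m : ℕ} (f : MvPolynomial (Fin n) ℝ)
    (g : Fin m → MvPolynomial (Fin n) ℝ)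
    (hfin : ((fun x => eval x f) '' Cset g).Finite) :
    ((fun p => eval p.1 f) '' VFJ f g).Finite := by
  let I : Ideal (MvPolynomial (Fin n ⊕ Fin (m + 1)) ℝ) :=
    ⨅ p ∈ VFJ f g, RingHom.ker (eval (Sum.elim p.1 p.2))
  have hI (q) : q ∈ I ↔ ∀ p ∈ VFJ f g, eval (Sum.elim p.1 p.2) q = 0 := by
    simp only [I, Ideal.mem_iInf, RingHom.mem_ker]
  have hinl (p : (Fin n → ℝ) × (Fin (m + 1) → ℝ)) (q : MvPolynomial (Fin n) ℝ) :
      eval (Sum.elim p.1 p.2) (rename Sum.inl q) = eval p.1 q := by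
    rw [eval_rename, Sum.elim_comp_inl]
  have key : ∀ P ∈ I.minimalPrimes, {c : ℝ | ∃ p ∈ VFJ f g,
      P ≤ RingHom.ker (eval (Sum.elim p.1 p.2)) ∧ eval p.1 f = c}.Finite := by
    intro P hP
    have := hP.1.1
    by_cases h0 : X (Sum.inr 0) ∈ P
    · refine hfin.subset ?_
      rintro _ ⟨p, hp, hPp, rfl⟩
      have hp0 : p.2 0 = 0 := by simpa using hPp h0
      obtain ⟨h1, h2, h3⟩ := hp
      refine ⟨p.1, ⟨fun j => p.2 j.succ, fun hz => ?_, fun i => ?_, h2⟩, rfl⟩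
      · have hz' (j : Fin m) : p.2 j.succ = 0 := congrFun hz j
        simp [Fin.sum_univ_succ, hp0, hz'] at h3
      · rw [← h1 i, hp0, zero_mul]
    · refine (finite_values_of_fritzJohn_prime f g P (fun i => hP.1.2 ?_)
        (fun j => hP.1.2 ?_) h0).subset ?_
      · rw [hI]
        rintro p ⟨h1, -, -⟩
        simp [hinl, h1]
      · rw [hI]
        rintro p ⟨-, h2, -⟩
        simp [hinl, h2]
      · rintro _ ⟨p, -, hPp, rfl⟩
        exact ⟨_, fun q hq => hPp hq, hinl p f⟩
  refine ((I.finite_minimalPrimes_of_isNoetherianRing _).biUnion key).subset ?_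
  rintro _ ⟨p, hp, rfl⟩
  have hle : I ≤ RingHom.ker (eval (Sum.elim p.1 p.2)) := fun q hq => (hI q).1 hq p hp
  have := RingHom.ker_isPrime (eval (Sum.elim p.1 p.2))
  obtain ⟨P, hP, hPp⟩ := Ideal.exists_minimalPrimes_le hle
  exact Set.mem_biUnion hP ⟨p, hp, hPp, rfl⟩

theorem isSOS_iff_isSumSq {σ : Type*} {p : MvPolynomial σ ℝ} : IsSOS p ↔ IsSumSq p := by
  constructor
  · rintro ⟨k, q, rfl⟩
    exact IsSumSq.sum fun i _ => by rw [sq]; exact .mul_self _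
  · intro h
    induction h with
    | zero => exact ⟨0, Fin.elim0, by simp⟩
    | sq_add a _ ih =>
      obtain ⟨k, q, rfl⟩ := ih
      exact ⟨k + 1, Fin.cons a q, by simp [Fin.sum_univ_succ, sq]⟩

theorem InQM.isQuadraticModule {σ ι : Type*} [Fintype ι] (g : ι → MvPolynomial σ ℝ) :
    IsQuadraticModule {p | InQM g p} where
  one_mem := ⟨1, 0, by simp [isSOS_iff_isSumSq], by simp [isSOS_iff_isSumSq], by simp⟩
  add_mem := by
    rintro _ _ ⟨s, t, hs, ht, rfl⟩ ⟨s', t', hs', ht', rfl⟩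
    simp only [isSOS_iff_isSumSq] at hs ht hs' ht'
    refine ⟨s + s', t + t', isSOS_iff_isSumSq.2 (hs.add hs'),
      fun j => isSOS_iff_isSumSq.2 ((ht j).add (ht' j)), ?_⟩
    simp only [Pi.add_apply, add_mul, Finset.sum_add_distrib]
    ring
  sq_mul_mem := by
    rintro b _ ⟨s, t, hs, ht, rfl⟩
    simp only [isSOS_iff_isSumSq] at hs ht
    have hb : IsSumSq (b ^ 2) := by rw [sq]; exact .mul_self b
    refine ⟨b ^ 2 * s, fun j => b ^ 2 * t j, isSOS_iff_isSumSq.2 (hb.mul hs),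
      fun j => isSOS_iff_isSumSq.2 (hb.mul (ht j)), ?_⟩
    simp only [mul_add, Finset.mul_sum, mul_assoc]

theorem InQM.generator {σ ι : Type*} [Fintype ι] (g : ι → MvPolynomial σ ℝ) (j : ι) :
    InQM g (g j) := by
  classical
  refine ⟨0, Pi.single j 1, by simp [isSOS_iff_isSumSq], fun i => ?_, ?_⟩
  · rw [isSOS_iff_isSumSq]
    by_cases h : i = j
    · subst h; simp
    · simp [h]
  · simp [Pi.single_apply]

theorem InQM.rename {σ τ ι : Type*} [Fintype ι] {g : ι → MvPolynomial σ ℝ}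
    {p : MvPolynomial σ ℝ} (hp : InQM g p) (e : σ → τ) :
    InQM (fun j => rename e (g j)) (rename e p) := by
  obtain ⟨s, t, hs, ht, rfl⟩ := hp
  have hsos {q : MvPolynomial σ ℝ} : IsSOS q → IsSOS (MvPolynomial.rename e q) := by
    rintro ⟨k, r, rfl⟩
    exact ⟨k, fun i => MvPolynomial.rename e (r i), by simp⟩
  exact ⟨_, fun j => MvPolynomial.rename e (t j), hsos hs, fun j => hsos (ht j), by simp⟩

/-- If the variables are bounded on `W` modulo the quadratic module of `g`, and no point of the
Zariski closure of `W` satisfies `g ≥ 0`, then `-1` agrees on `W` with an element of the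
quadratic module. -/
theorem exists_inQM_eval_eq_neg_one {σ ι : Type*} [Fintype ι] (g : ι → MvPolynomial σ ℝ)
    (W : Set (σ → ℝ))
    (hb : ∀ i, ∃ (N : ℝ) (q : MvPolynomial σ ℝ), InQM g q ∧ ∀ z ∈ W, eval z q = N - z i ^ 2)
    (hW : ∀ z, (∀ j, 0 ≤ eval z (g j)) → ∃ p, (∀ w ∈ W, eval w p = 0) ∧ eval z p ≠ 0) :
    ∃ q, InQM g q ∧ ∀ z ∈ W, eval z q = -1 := by
  have hQ := InQM.isQuadraticModule g
  let M : Set (MvPolynomial σ ℝ) := {p | ∃ q, InQM g q ∧ ∀ z ∈ W, eval z q = eval z p}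
  have hM : IsQuadraticModule M :=
    { one_mem := ⟨1, hQ.one_mem, fun _ _ => rfl⟩
      add_mem := by
        rintro a b ⟨q, hq, h⟩ ⟨q', hq', h'⟩
        exact ⟨_, hQ.add_mem hq hq', fun z hz => by simp [h z hz, h' z hz]⟩
      sq_mul_mem := by
        rintro b a ⟨q, hq, h⟩
        exact ⟨_, hQ.sq_mul_mem b hq, fun z hz => by simp [h z hz]⟩ }
  have hbdd : hM.bounded = ⊤ := by
    rw [eq_top_iff, ← adjoin_range_X, Algebra.adjoin_le_iff]
    rintro _ ⟨i, rfl⟩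
    obtain ⟨N, q, hq, h⟩ := hb i
    exact hM.mem_bounded_of_sub_sq_mem (N := N) ⟨q, hq, fun z hz => by
      simp [h z hz, algebraMap_eq]⟩
  by_contra hcon
  obtain ⟨φ, hφ⟩ := hM.exists_algHom_nonneg hbdd fun ⟨q, hq, h⟩ =>
    hcon ⟨q, hq, fun z hz => by simp [h z hz]⟩
  have hφe (p) : φ p = eval (fun i => φ (X i)) p := by
    rw [aeval_unique φ, ← coe_aeval_eq_eval]
    simp [Function.comp_def]
  obtain ⟨p, hp, hp'⟩ := hW (fun i => φ (X i)) fun j => by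
    rw [← hφe]
    exact hφ _ ⟨_, InQM.generator g j, fun _ _ => rfl⟩
  rw [← hφe] at hp'
  have h1 := hφ p ⟨0, hQ.zero_mem, fun z hz => by simp [hp z hz]⟩
  have h2 := hφ (-p) ⟨0, hQ.zero_mem, fun z hz => by simp [hp z hz]⟩
  rw [map_neg] at h2
  exact hp' (by linarith)

/-- If `f` is non-negative on `S(g)`, `f(C(g))` is finite, and `S(g)` satisfies the
Archimedean condition, then there is `q ∈ Q(g)[x, λ̄]` with `f − q` vanishing on `V(h_FJ)`. -/
theorem rep_quadratic_module_FJ {n m : ℕ} (f : MvPolynomial (Fin n) ℝ)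
    (g : Fin m → MvPolynomial (Fin n) ℝ)
    (hf : ∀ x ∈ Sg g, 0 ≤ eval x f)
    (hfin : ((fun x => eval x f) '' Cset g).Finite)
    (harch : ArchCond g) :
    ∃ q : MvPolynomial (Fin n ⊕ Fin (m + 1)) ℝ,
      InQM (fun j => rename Sum.inl (g j)) q ∧
      ∀ p ∈ VFJ f g, eval (Sum.elim p.1 p.2) (rename Sum.inl f - q) = 0 := by
  classical
  have hF := finite_image_VFJ f g hfin
  have hQ := InQM.isQuadraticModule (fun j => rename (Sum.inl (β := Fin (m + 1))) (g j))
  have hinl (p : (Fin n → ℝ) × (Fin (m + 1) → ℝ)) (q : MvPolynomial (Fin n) ℝ) :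
      eval (Sum.elim p.1 p.2) (rename Sum.inl q) = eval p.1 q := by
    rw [eval_rename, Sum.elim_comp_inl]
  obtain ⟨R, -, hR⟩ := harch
  have hlevel (c : ℝ) : ∃ q, InQM (fun j => rename (Sum.inl (β := Fin (m + 1))) (g j)) q ∧
      ∀ p ∈ VFJ f g, eval p.1 f = c → eval (Sum.elim p.1 p.2) q = c := by
    rcases le_or_gt 0 c with hc | hc
    · exact ⟨C c, hQ.algebraMap_mem hc, fun p _ _ => by simp⟩
    obtain ⟨q, hq, hq1⟩ := exists_inQM_eval_eq_neg_one
      (fun j => rename (Sum.inl (β := Fin (m + 1))) (g j))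
      {z | ∃ p ∈ VFJ f g, eval p.1 f = c ∧ z = Sum.elim p.1 p.2} (by
        rintro (i | j)
        · refine ⟨R, _, hQ.add_mem (hR.rename Sum.inl) (hQ.sum_mem (Finset.univ.erase i)
            fun k _ => hQ.sq_mem (X (Sum.inl k))), ?_⟩
          rintro _ ⟨p, -, -, rfl⟩
          simp
        · refine ⟨1, _, hQ.sum_mem (Finset.univ.erase j)
            fun k _ => hQ.sq_mem (X (Sum.inr k)), ?_⟩
          rintro _ ⟨p, ⟨-, -, hp⟩, -, rfl⟩
          simp [hp]) (by
        intro z hz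
        refine ⟨rename Sum.inl f - C c, ?_, ?_⟩
        · rintro _ ⟨p, -, hpc, rfl⟩
          simp [hinl, hpc]
        · have := hf (z ∘ Sum.inl) fun j => by simpa [eval_rename] using hz j
          rw [map_sub, eval_rename, eval_C]
          linarith)
    refine ⟨_, hQ.algebraMap_mul_mem (neg_nonneg.2 hc.le) hq, fun p hp hpc => ?_⟩
    simp [algebraMap_eq, hq1 _ ⟨p, hp, hpc, rfl⟩]
  choose q hq hqc using hlevel
  let L (c : ℝ) : MvPolynomial (Fin n ⊕ Fin (m + 1)) ℝ :=
    Polynomial.aeval (rename Sum.inl f) (Lagrange.basis hF.toFinset id c)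
  have hL (p : (Fin n → ℝ) × (Fin (m + 1) → ℝ)) (c : ℝ) : eval (Sum.elim p.1 p.2) (L c) =
      (Lagrange.basis hF.toFinset id c).eval (eval p.1 f) := by
    rw [← hinl, ← coe_aeval_eq_eval, RingHom.coe_coe, ← Polynomial.aeval_algHom_apply,
      Polynomial.coe_aeval_eq_eval]
  refine ⟨∑ c ∈ hF.toFinset, L c ^ 2 * q c,
    hQ.sum_mem _ fun c _ => hQ.sq_mul_mem _ (hq c), fun p hp => ?_⟩
  have hmem : eval p.1 f ∈ hF.toFinset := hF.mem_toFinset.2 ⟨p, hp, rfl⟩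
  rw [map_sub, hinl, map_sum, Finset.sum_eq_single_of_mem _ hmem]
  · have h1 := Lagrange.eval_basis_self (Set.injOn_id (hF.toFinset : Set ℝ)) hmem
    rw [id] at h1
    rw [map_mul, map_pow, hL, h1, hqc _ p hp rfl]
    ring
  · intro c _ hne
    have h1 := Lagrange.eval_basis_of_ne (v := id) hne hmem
    rw [id] at h1
    rw [map_mul, map_pow, hL, h1]
    ring
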